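/- For every integer n ≥ 3, δ_n < 1/2 if and only if n is not divisible by 8; and δ_n = 1/2 whenever 8 divides n. Here δ_n := 1 − 1/(2·cos² Δ_n) with Δ_n := min over integers m, t of |2πm/n − (2t+1)π/4|. -/

import Mathlib

open Real

/-- `Δ_n`: the minimal distance `|2πm/n − (2t+1)π/4|` over integers `m, t`. -/
noncomputable def Delta (n : ℕ) : ℝ :=
  sInf {x : ℝ | ∃ m t : ℤ,
    x = |2 * Real.pi * (m : ℝ) / (n : ℝ) - (2 * (t : ℝ) + 1) * Real.pi / 4|}

/-- `δ_n := 1 − 1/(2 cos² Δ_n)`. -/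
noncomputable def deltaCycle (n : ℕ) : ℝ :=
  1 - 1 / (2 * Real.cos (Delta n) ^ 2)

theorem bddBelow_Delta_set (n : ℕ) : BddBelow {x : ℝ | ∃ m t : ℤ,
    x = |2 * Real.pi * (m : ℝ) / (n : ℝ) - (2 * (t : ℝ) + 1) * Real.pi / 4|} :=
  ⟨0, by rintro x ⟨m, t, rfl⟩; exact abs_nonneg _⟩

theorem Delta_nonneg (n : ℕ) : 0 ≤ Delta n :=
  Real.sInf_nonneg (by rintro x ⟨m, t, rfl⟩; exact abs_nonneg _)

theorem Delta_le (n : ℕ) (m t : ℤ) :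
    Delta n ≤ |2 * Real.pi * (m : ℝ) / (n : ℝ) - (2 * (t : ℝ) + 1) * Real.pi / 4| :=
  csInf_le (bddBelow_Delta_set n) ⟨m, t, rfl⟩

theorem Delta_le_pi_div_four (n : ℕ) : Delta n ≤ Real.pi / 4 := by
  have h := Delta_le n 0 0
  have hpi := Real.pi_pos
  rw [show 2 * Real.pi * ((0 : ℤ) : ℝ) / (n : ℝ) - (2 * ((0 : ℤ) : ℝ) + 1) * Real.pi / 4
    = -(Real.pi / 4) by push_cast; ring, abs_neg, abs_of_pos (by positivity)] at h
  exact h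

theorem Delta_eq_zero_of_dvd {n : ℕ} (hn : 0 < n) (h : 8 ∣ n) : Delta n = 0 := by
  obtain ⟨k, rfl⟩ := h
  have hk : (k : ℝ) ≠ 0 := by
    have : k ≠ 0 := by omega
    exact_mod_cast this
  refine le_antisymm ((Delta_le _ k 0).trans_eq ?_) (Delta_nonneg _)
  rw [abs_eq_zero]
  push_cast
  field_simp
  ring

theorem Delta_pos_of_not_dvd {n : ℕ} (hn : 0 < n) (h : ¬ 8 ∣ n) : 0 < Delta n := by
  have hn' : (0 : ℝ) < n := by exact_mod_cast hn
  have hpi := Real.pi_pos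
  have hc : 0 < Real.pi / (4 * n) := by positivity
  refine hc.trans_le (le_csInf ⟨_, 0, 0, rfl⟩ ?_)
  rintro x ⟨m, t, rfl⟩
  have hne : 8 * m - (2 * t + 1) * n ≠ 0 := by
    intro h0
    have hdvd : (8 : ℤ) ∣ (2 * t + 1) * n := ⟨m, by linarith⟩
    have hcop : IsCoprime (8 : ℤ) (2 * t + 1) :=
      IsCoprime.pow_left (m := 3) (x := (2 : ℤ)) ⟨-t, 1, by ring⟩
    exact h (by exact_mod_cast hcop.dvd_of_dvd_mul_left hdvd)
  have hone : (1 : ℝ) ≤ |8 * (m : ℝ) - (2 * t + 1) * n| := by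
    exact_mod_cast Int.one_le_abs hne
  rw [show 2 * Real.pi * (m : ℝ) / (n : ℝ) - (2 * (t : ℝ) + 1) * Real.pi / 4
    = Real.pi / (4 * n) * (8 * (m : ℝ) - (2 * t + 1) * n) by field_simp; ring,
    abs_mul, abs_of_pos hc]
  exact le_mul_of_one_le_right hc.le hone

theorem deltaCycle_eq_half_of_dvd {n : ℕ} (hn : 0 < n) (h : 8 ∣ n) : deltaCycle n = 1 / 2 := by
  rw [deltaCycle, Delta_eq_zero_of_dvd hn h, Real.cos_zero]
  norm_num

theorem deltaCycle_lt_half_of_not_dvd {n : ℕ} (hn : 0 < n) (h : ¬ 8 ∣ n) :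
    deltaCycle n < 1 / 2 := by
  have hpos := Delta_pos_of_not_dvd hn h
  have hle := Delta_le_pi_div_four n
  have hpi := Real.pi_pos
  have hcos : 0 < Real.cos (Delta n) := Real.cos_pos_of_mem_Ioo ⟨by linarith, by linarith⟩
  have hsin : 0 < Real.sin (Delta n) := Real.sin_pos_of_pos_of_lt_pi hpos (by linarith)
  have hlt : Real.cos (Delta n) ^ 2 < 1 := by
    nlinarith [Real.sin_sq_add_cos_sq (Delta n)]
  have hinv : 1 / 2 < 1 / (2 * Real.cos (Delta n) ^ 2) :=
    one_div_lt_one_div_of_lt (by positivity) (by linarith)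
  rw [deltaCycle]
  linarith

theorem stmt6 (n : ℕ) (hn : 3 ≤ n) :
    (deltaCycle n < 1 / 2 ↔ ¬ (8 ∣ n)) ∧ (8 ∣ n → deltaCycle n = 1 / 2) := by
  have hpos : 0 < n := by omega
  refine ⟨⟨fun hlt h => ?_, deltaCycle_lt_half_of_not_dvd hpos⟩, deltaCycle_eq_half_of_dvd hpos⟩
  exact hlt.ne (deltaCycle_eq_half_of_dvd hpos h)
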